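/- arXiv:1901.02063 — 3 statements merged into one kernel-verified Lean document; each statement's English description precedes it below -/
import Mathlib

section
/- Let V be a finite set of clusters with at least two elements and let d : V → V → ℝ be a symmetric inter-cluster distance function. Then there exists at least one reliable linkage: there are distinct clusters p ≠ q such that d p q ≤ d p r for every r ≠ p and d p q ≤ d q r for every r ≠ q. (Consequently the reliable agglomerative clustering algorithm can always establish at least one linkage at each step and hence makes progress.) -/
/-- On a finite set of at least two clusters with a symmetric inter-cluster
distance function `d`, there always exists at least one reliable linkage:
a pair of distinct clusters `p ≠ q` that are mutually nearest neighbors. -/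
theorem exists_reliable_linkage {V : Type*} [Fintype V]
    (h2 : 1 < Fintype.card V)
    (d : V → V → ℝ) (hsymm : ∀ p q : V, d p q = d q p) :
    ∃ p q : V, p ≠ q ∧ (∀ r : V, r ≠ p → d p q ≤ d p r) ∧
      (∀ r : V, r ≠ q → d p q ≤ d q r) := by
  obtain ⟨a, b, hab⟩ := Fintype.one_lt_card_iff.mp h2
  obtain ⟨⟨p, q⟩, hpq, hmin⟩ := Set.exists_min_image {x : V × V | x.1 ≠ x.2}
    (fun x => d x.1 x.2) (Set.toFinite _) ⟨(a, b), hab⟩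
  exact ⟨p, q, hpq, fun r hr => hmin (p, r) hr.symm, fun r hr => hmin (q, r) hr.symm⟩
end

section
/- Let G be a simple graph on a finite nonempty vertex set V, assume G is connected, and let w be a real-valued weight function on the edges of G that is injective (all edge weights are pairwise distinct). Let S be a nonempty proper subset of V such that at least one edge of G crosses the cut (S, V ∖ S), and let e be the edge of minimum weight among all edges of G crossing this cut. Then every minimum spanning tree of G (with respect to w) contains e. (This is the key step in the proof of Theorem 1: when a tree T_p of the current forest is joined to its nearest tree via the smallest inter-tree linkage, the selected edge necessarily belongs to the final minimum spanning tree; choosing any larger crossing edge would yield a spanning tree of strictly larger total weight.) -/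
namespace SimpleGraph

variable {V : Type*} {G : SimpleGraph V}

theorem edgeSet_sup_edge_deleteEdges {a b : V} {f : Sym2 V} (hne : a ≠ b)
    (hab : ¬ G.Adj a b) (hf : f ∈ G.edgeSet) :
    ((G ⊔ edge a b).deleteEdges {f}).edgeSet = insert s(a, b) (G.edgeSet \ {f}) := by
  have hfe : s(a, b) ∉ ({f} : Set (Sym2 V)) := by
    rintro rfl
    exact hab hf
  rw [edgeSet_deleteEdges, edgeSet_sup, edgeSet_edge_of_ne hne, Set.union_singleton,
    Set.insert_sdiff_of_notMem _ hfe]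

/-- Adding an edge to a tree and deleting an edge of the path between its endpoints
yields a tree. -/
theorem IsTree.sup_edge_deleteEdges [Finite V] (hG : G.IsTree) {a b : V} (hne : a ≠ b)
    (hab : ¬ G.Adj a b) {p : G.Walk a b} (hp : p.IsPath) {f : Sym2 V} (hf : f ∈ p.edges) :
    ((G ⊔ edge a b).deleteEdges {f}).IsTree := by
  have hfG : f ∈ G.edgeSet := p.edges_subset_edgeSet hf
  have hba : (G ⊔ edge a b).Adj b a := by simp [edge_adj, hne.symm]
  have hcycle : (Walk.cons hba (p.mapLe (le_sup_left : G ≤ G ⊔ edge a b))).IsCycle := by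
    rw [Walk.cons_isCycle_iff, Walk.edges_mapLe_eq_edges]
    exact ⟨hp.mapLe _, fun h ↦ hab (p.adj_of_mem_edges h).symm⟩
  have hbridge : ¬ (G ⊔ edge a b).IsBridge f := fun h ↦ by
    refine h.notMem_edges_of_isCycle hcycle ?_
    rw [Walk.edges_cons, Walk.edges_mapLe_eq_edges]
    exact List.mem_cons_of_mem _ hf
  rw [isTree_iff_connected_and_card]
  constructor
  · have hconn : (G ⊔ edge a b).Connected := hG.connected.mono le_sup_left
    induction f with
    | h x y => exact hconn.connected_delete_edge_of_not_isBridge hbridge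
  · rw [edgeSet_sup_edge_deleteEdges hne hab hfG, Nat.card_coe_set_eq,
      Set.ncard_exchange (G.mem_edgeSet.not.mpr hab) hfG, ← Nat.card_coe_set_eq]
    exact (isTree_iff_connected_and_card.mp hG).2

end SimpleGraph


/-- Strong cut property for distinct edge weights.  Let `G` be a connected simple
graph on a finite nonempty vertex set with pairwise-distinct edge weights `w`, let
`S` be a nonempty proper subset of the vertices, and let `{a, b}` (with `a ∈ S`,
`b ∉ S`) be the edge of minimum weight among all edges of `G` crossing the cut
`(S, Sᶜ)`.  Then every minimum spanning tree of `G` contains the edge `{a, b}`. -/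
theorem cut_property_all_mst {V : Type*} [Fintype V] [Nonempty V]
    (G : SimpleGraph V) (hG : G.Connected) (w : Sym2 V → ℝ)
    (hw : Set.InjOn w G.edgeSet)
    (S : Set V) (hS : S.Nonempty) (hS' : S ≠ Set.univ)
    (a b : V) (hab : G.Adj a b) (ha : a ∈ S) (hb : b ∉ S)
    (hmin : ∀ a' b' : V, G.Adj a' b' → a' ∈ S → b' ∉ S → w s(a, b) ≤ w s(a', b')) :
    ∀ T : SimpleGraph V, T ≤ G → T.IsTree →
      (∀ T' : SimpleGraph V, T' ≤ G → T'.IsTree →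
        ∑ᶠ e ∈ T.edgeSet, w e ≤ ∑ᶠ e ∈ T'.edgeSet, w e) →
      T.Adj a b := by
  intro T hTG hT hTmin
  by_contra hTab
  have hne : a ≠ b := hab.ne
  obtain ⟨p, hp⟩ := hT.connected.exists_isPath a b
  obtain ⟨d, hd, hdS, hdS'⟩ := p.exists_boundary_dart S ha hb
  have hdp : d.edge ∈ p.edges := List.mem_map_of_mem hd
  have hdT : d.edge ∈ T.edgeSet := d.edge_mem
  have hlt : w s(a, b) < w d.edge := by
    refine lt_of_le_of_ne (hmin d.fst d.snd (hTG d.adj) hdS hdS') fun h ↦ hTab ?_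
    rw [← SimpleGraph.mem_edgeSet, hw hab (SimpleGraph.edgeSet_mono hTG hdT) h]
    exact hdT
  have hle := hTmin ((T ⊔ SimpleGraph.edge a b).deleteEdges {d.edge})
    ((SimpleGraph.deleteEdges_le _).trans
      (sup_le hTG ((SimpleGraph.edge_le_iff G).mpr (Or.inr hab))))
    (hT.sup_edge_deleteEdges hne hTab hp hdp)
  have hsum : ∑ᶠ e ∈ T.edgeSet, w e = w d.edge + ∑ᶠ e ∈ T.edgeSet \ {d.edge}, w e := by
    rw [← finsum_mem_insert w (by simp) (Set.toFinite _), Set.insert_sdiff_singleton,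
      Set.insert_eq_of_mem hdT]
  rw [SimpleGraph.edgeSet_sup_edge_deleteEdges hne hTab hdT,
    finsum_mem_insert w (fun h ↦ hTab h.1) (Set.toFinite _), hsum] at hle
  linarith
end

section
/- Let G be a simple graph on a finite vertex set V with a real-valued weight function w on its edges that is injective (all edge weights are pairwise distinct), and suppose every vertex of G has at least one incident edge. For each vertex v, let e_v denote the edge of minimum weight among the edges of G incident to v. Then the spanning subgraph of G whose edge set is { e_v : v ∈ V } contains no cycle. (This guarantees that simultaneously establishing, at one step of the reliable agglomerative algorithm with the single linkage criterion, the minimal linkage of every current tree produces a forest, so that merging the resulting connected components is well defined and the procedure builds a spanning tree.) -/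
/-- Let `G` be a simple graph on a finite vertex set with pairwise-distinct edge
weights `w`, in which every vertex has at least one incident edge.  For each vertex
`v`, let `e v` be the edge of minimum weight among the edges of `G` incident to `v`.
Then the spanning subgraph of `G` whose edge set is `{ e v : v ∈ V }` contains no
cycle. -/
theorem min_incident_edges_acyclic {V : Type*} [Fintype V]
    (G : SimpleGraph V) (w : Sym2 V → ℝ) (hw : Set.InjOn w G.edgeSet)
    (e : V → Sym2 V)
    (he : ∀ v : V, e v ∈ G.edgeSet ∧ v ∈ e v)
    (hmin : ∀ v : V, ∀ e' ∈ G.edgeSet, v ∈ e' → w (e v) ≤ w e') :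
    (SimpleGraph.fromEdgeSet (Set.range e)).IsAcyclic := by
  classical
  intro u p hp
  obtain ⟨f, hfp, hfmax⟩ := p.edges.toFinset.exists_max_image w
    ⟨_, List.mem_toFinset.2 (p.mk_start_snd_mem_edges hp.not_nil)⟩
  rw [List.mem_toFinset] at hfp
  have hrange : ∀ g ∈ p.edges, g ∈ Set.range e := fun g hg => by
    have := p.edges_subset_edgeSet hg
    rw [SimpleGraph.edgeSet_fromEdgeSet] at this
    exact this.1
  obtain ⟨v, rfl⟩ := hrange f hfp
  have heq : ∀ g ∈ p.edges, v ∈ g → g = e v := fun g hg hvg => by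
    have hgG : g ∈ G.edgeSet := by
      obtain ⟨x, rfl⟩ := hrange g hg
      exact (he x).1
    exact hw hgG (he v).1
      (le_antisymm (hfmax g (List.mem_toFinset.2 hg)) (hmin v g hgG hvg))
  have hv : v ∈ p.support := p.mem_support_of_mem_edges hfp (he v).2
  have hq := hp.rotate hv
  have hmem : ∀ g ∈ (p.rotate v hv).edges, g ∈ p.edges := fun g hg =>
    (p.rotate_edges v hv).mem_iff.1 hg
  have hsnd := heq _ (hmem _ (SimpleGraph.Walk.mk_start_snd_mem_edges hq.not_nil)) (by simp)
  have hpen := heq _ (hmem _ (SimpleGraph.Walk.mk_penultimate_end_mem_edges hq.not_nil))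
    (by simp)
  rw [← hpen, Sym2.eq_swap, Sym2.congr_left] at hsnd
  exact hq.snd_ne_penultimate hsnd
end
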